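/- Let G be a finite group and k a field. In the partial group algebra k_par G, let A_par be the unital subalgebra generated by the elements ε_g = [g][g⁻¹], g ∈ G. Then the family of elements (P_X), indexed by the subsets X ⊆ G with e ∈ X, is a k-linear basis of A_par. -/

import Mathlib

open scoped Pointwise

/-- A partial representation of a group `G` on a unital (`k`-)algebra `B`. -/
def IsPartialRep {G B : Type*} [Group G] [Monoid B] (π : G → B) : Prop :=
  π 1 = 1 ∧
  (∀ g h : G, π g * π h * π h⁻¹ = π (g * h) * π h⁻¹) ∧
  (∀ g h : G, π g⁻¹ * π g * π h = π g⁻¹ * π (g * h))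

/-- The defining relations of the partial group algebra. -/
inductive ParRel (k G : Type*) [CommSemiring k] [Group G] :
    FreeAlgebra k G → FreeAlgebra k G → Prop
  | one : ParRel k G (FreeAlgebra.ι k (1 : G)) 1
  | pr2 (g h : G) : ParRel k G
      (FreeAlgebra.ι k g * FreeAlgebra.ι k h * FreeAlgebra.ι k h⁻¹)
      (FreeAlgebra.ι k (g * h) * FreeAlgebra.ι k h⁻¹)
  | pr3 (g h : G) : ParRel k G
      (FreeAlgebra.ι k g⁻¹ * FreeAlgebra.ι k g * FreeAlgebra.ι k h)
      (FreeAlgebra.ι k g⁻¹ * FreeAlgebra.ι k (g * h))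

/-- The partial group algebra `k_par G`. -/
abbrev ParAlg (k G : Type*) [CommSemiring k] [Group G] := RingQuot (ParRel k G)

/-- The generator `[g]` of the partial group algebra. -/
noncomputable def parGen (k : Type*) {G : Type*} [CommSemiring k] [Group G] (g : G) :
    ParAlg k G :=
  RingQuot.mkAlgHom k (ParRel k G) (FreeAlgebra.ι k g)

/-- The idempotent `P_X = (∏_{r ∈ X} ε_r)·(∏_{s ∉ X} (1 - ε_s))`, where `ε_g = π(g)π(g⁻¹)`. -/
noncomputable def parP {G B : Type*} [Group G] [Fintype G] [DecidableEq G] [Ring B]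
    (π : G → B) (X : Finset G) : B :=
  (X.toList.map fun r => π r * π r⁻¹).prod *
    (Xᶜ.toList.map fun s => 1 - π s * π s⁻¹).prod

/-- `Γ_X = Σ_{Y ∼ X} P_Y`, where `Y ∼ X` iff `Y = gX` for some `g ∈ G`. -/
noncomputable def parGamma {G B : Type*} [Group G] [Fintype G] [DecidableEq G] [Ring B]
    (π : G → B) (X : Finset G) : B :=
  ∑ Y ∈ Finset.univ.filter (fun Y : Finset G => ∃ g : G, Y = g • X), parP π Y

/-- The product `∏_{i ∈ X} e i * ∏_{i ∉ X} (1 - e i)` in a commutative ring. -/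
def booleanAtom {ι A : Type*} [Fintype ι] [DecidableEq ι] [CommRing A] (e : ι → A)
    (X : Finset ι) : A :=
  (∏ r ∈ X, e r) * ∏ s ∈ Xᶜ, (1 - e s)

theorem sum_booleanAtom {ι A : Type*} [Fintype ι] [DecidableEq ι] [CommRing A] (e : ι → A) :
    ∑ X : Finset ι, booleanAtom e X = 1 := by
  have h := Finset.prod_add e (fun i => 1 - e i) Finset.univ
  simp only [add_sub_cancel, Finset.prod_const_one, Finset.powerset_univ] at h
  simpa only [booleanAtom, Finset.compl_eq_univ_sdiff] using h.symm

theorem mul_booleanAtom_of_mem {ι A : Type*} [Fintype ι] [DecidableEq ι] [CommRing A]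
    {e : ι → A} (he : ∀ i, IsIdempotentElem (e i)) {X : Finset ι} {i : ι} (hi : i ∈ X) :
    e i * booleanAtom e X = booleanAtom e X := by
  rw [booleanAtom, ← Finset.mul_prod_erase X e hi, ← mul_assoc, ← mul_assoc, (he i).eq]

theorem mul_booleanAtom_of_notMem {ι A : Type*} [Fintype ι] [DecidableEq ι] [CommRing A]
    {e : ι → A} (he : ∀ i, IsIdempotentElem (e i)) {X : Finset ι} {i : ι} (hi : i ∉ X) :
    e i * booleanAtom e X = 0 := by
  rw [booleanAtom, ← Finset.mul_prod_erase Xᶜ (fun s => 1 - e s) (Finset.mem_compl.2 hi),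
    mul_left_comm, ← mul_assoc (e i), (he i).mul_one_sub_self, zero_mul, mul_zero]

/-- If `parP π` and `booleanAtom a` are built from elements with the same images under two ring
homomorphisms, then they have the same image. -/
theorem map_parP_eq_map_booleanAtom {G A B C : Type*} [Group G] [Fintype G] [DecidableEq G]
    [CommRing A] [Ring B] [Ring C] (f : B →+* C) (j : A →+* C) {π : G → B} {a : G → A}
    (h : ∀ g, f (π g * π g⁻¹) = j (a g)) (X : Finset G) :
    f (parP π X) = j (booleanAtom a X) := by
  have h₁ : f ∘ (fun r => π r * π r⁻¹) = j ∘ a := funext h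
  have h₂ : f ∘ (fun r => 1 - π r * π r⁻¹) = j ∘ fun r => 1 - a r := by
    funext g
    simp only [Function.comp_apply, map_sub, map_one, h g]
  rw [parP, booleanAtom, map_mul, map_mul, map_list_prod, map_list_prod, List.map_map,
    List.map_map, h₁, h₂, ← Finset.prod_map_toList, ← Finset.prod_map_toList, map_list_prod,
    map_list_prod, List.map_map, List.map_map]

namespace IsPartialRep

variable {G B : Type*} [Group G] [Monoid B] {π : G → B}

theorem mul_mul_inv (hπ : IsPartialRep π) (g h : G) :
    π g * (π h * π h⁻¹) = π (g * h) * π (g * h)⁻¹ * π g := by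
  have h₁ := hπ.2.1 g h
  have h₂ := hπ.2.2 (g * h)⁻¹ g
  simp only [inv_inv, mul_inv_rev, inv_mul_cancel_right] at h₂
  rw [← mul_assoc, h₁, mul_inv_rev, h₂]

theorem isIdempotentElem (hπ : IsPartialRep π) (g : G) :
    IsIdempotentElem (π g * π g⁻¹) := by
  have h := hπ.2.2 g⁻¹ g
  rw [inv_inv, inv_mul_cancel, hπ.1, mul_one] at h
  rw [IsIdempotentElem, ← mul_assoc, h]

theorem commute (hπ : IsPartialRep π) (g h : G) :
    π g * π g⁻¹ * (π h * π h⁻¹) = π h * π h⁻¹ * (π g * π g⁻¹) := by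
  rw [mul_assoc, hπ.mul_mul_inv g⁻¹ h, ← mul_assoc, hπ.mul_mul_inv g (g⁻¹ * h),
    mul_inv_cancel_left, mul_assoc]

end IsPartialRep

theorem isPartialRep_parGen (k G : Type*) [CommSemiring k] [Group G] :
    IsPartialRep (fun g : G => parGen k g) := by
  refine ⟨?_, fun g h => ?_, fun g h => ?_⟩
  · simpa [parGen] using RingQuot.mkAlgHom_rel k (ParRel.one (k := k) (G := G))
  · simpa [parGen] using RingQuot.mkAlgHom_rel k (ParRel.pr2 (k := k) g h)
  · simpa [parGen] using RingQuot.mkAlgHom_rel k (ParRel.pr3 (k := k) g h)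

/-- The algebra homomorphism out of `k_par G` induced by a partial representation. -/
noncomputable def parLift {k G B : Type*} [CommSemiring k] [Group G] [Semiring B] [Algebra k B]
    (π : G → B) (hπ : IsPartialRep π) : ParAlg k G →ₐ[k] B :=
  RingQuot.liftAlgHom k ⟨FreeAlgebra.lift k π, by
    rintro _ _ (_ | ⟨g, h⟩ | ⟨g, h⟩)
    · simpa using hπ.1
    · simpa using hπ.2.1 g h
    · simpa using hπ.2.2 g h⟩

theorem parLift_parGen {k G B : Type*} [CommSemiring k] [Group G] [Semiring B] [Algebra k B]
    (π : G → B) (hπ : IsPartialRep π) (g : G) :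
    parLift (k := k) π hπ (parGen k g) = π g := by
  simp [parLift, parGen]

theorem one_mem_inv_smul {G : Type*} [Group G] [DecidableEq G] {g : G} {Y : Finset G}
    (hg : g ∈ Y) : (1 : G) ∈ g⁻¹ • Y := by
  rw [Finset.mem_inv_smul_finset_iff]
  simpa using hg

/-- Partial translation of functions on the subsets of `G` containing `1`. -/
def partialTranslation (k G : Type*) [CommSemiring k] [Group G] [DecidableEq G] (g : G) :
    Module.End k ({X : Finset G // (1 : G) ∈ X} → k) where
  toFun f Y := if hg : g ∈ Y.1 then f ⟨g⁻¹ • Y.1, one_mem_inv_smul hg⟩ else 0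
  map_add' f f' := by
    funext Y
    by_cases hg : g ∈ Y.1 <;> simp [hg]
  map_smul' c f := by
    funext Y
    by_cases hg : g ∈ Y.1 <;> simp [hg]

theorem partialTranslation_apply {k G : Type*} [CommSemiring k] [Group G] [DecidableEq G] (g : G)
    (f : {X : Finset G // (1 : G) ∈ X} → k) (Y : {X : Finset G // (1 : G) ∈ X}) :
    partialTranslation k G g f Y =
      if hg : g ∈ Y.1 then f ⟨g⁻¹ • Y.1, one_mem_inv_smul hg⟩ else 0 :=
  rfl

theorem isPartialRep_partialTranslation (k G : Type*) [CommSemiring k] [Group G]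
    [DecidableEq G] : IsPartialRep (partialTranslation k G) := by
  refine ⟨?_, fun g h => ?_, fun g h => ?_⟩
  · ext1 f
    funext Y
    simp [partialTranslation_apply, Y.2]
  · refine LinearMap.ext fun f => funext fun Y => ?_
    by_cases h₁ : g ∈ Y.1 <;> by_cases h₂ : g * h ∈ Y.1 <;>
      simp [partialTranslation_apply, ← Finset.inv_smul_mem_iff, smul_smul, h₁, h₂]
  · refine LinearMap.ext fun f => funext fun Y => ?_
    by_cases h₁ : g⁻¹ ∈ Y.1 <;> by_cases h₂ : h ∈ Y.1 <;>
      simp [partialTranslation_apply, ← Finset.inv_smul_mem_iff, smul_smul, h₁, h₂, Y.2]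

theorem partialTranslation_mul_inv (k G : Type*) [CommSemiring k] [Group G] [DecidableEq G]
    (g : G) :
    partialTranslation k G g * partialTranslation k G g⁻¹ =
      Algebra.lmul k ({X : Finset G // (1 : G) ∈ X} → k) (fun Y => if g ∈ Y.1 then 1 else 0) := by
  refine LinearMap.ext fun f => funext fun Y => ?_
  by_cases hg : g ∈ Y.1 <;>
    simp [partialTranslation_apply, Finset.mem_inv_smul_finset_iff, smul_smul, hg, Y.2]

theorem booleanAtom_mem_indicator {k ι : Type*} [CommRing k] [Fintype ι] [DecidableEq ι]
    (p : Finset ι → Prop) (X : {X : Finset ι // p X}) :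
    booleanAtom (fun (i : ι) (Y : {X : Finset ι // p X}) => if i ∈ Y.1 then (1 : k) else 0) X.1 =
      Pi.single X 1 := by
  funext Y
  simp only [booleanAtom, Pi.mul_apply, Finset.prod_apply, Pi.sub_apply, Pi.one_apply]
  by_cases hXY : Y = X
  · subst hXY
    rw [Finset.prod_eq_one fun i hi => if_pos hi,
      Finset.prod_eq_one fun i hi => by rw [if_neg (Finset.mem_compl.1 hi), sub_zero], mul_one,
      Pi.single_eq_same]
  · rw [Pi.single_eq_of_ne hXY]
    by_cases hsub : X.1 ⊆ Y.1
    · have hne : ¬ Y.1 ⊆ X.1 := fun h => hXY (Subtype.ext (h.antisymm hsub))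
      obtain ⟨i, hiY, hiX⟩ := Finset.not_subset.1 hne
      rw [Finset.prod_eq_zero (s := X.1ᶜ) (Finset.mem_compl.2 hiX) (by simp [hiY]), mul_zero]
    · obtain ⟨i, hiX, hiY⟩ := Finset.not_subset.1 hsub
      rw [Finset.prod_eq_zero hiX (by simp [hiY]), zero_mul]

theorem linearIndependent_parP (k G : Type*) [CommRing k] [Group G] [Fintype G] [DecidableEq G] :
    LinearIndependent k
      (fun X : {X : Finset G // (1 : G) ∈ X} => parP (fun g : G => parGen k g) X.1) := by
  let φ : ParAlg k G →ₐ[k] Module.End k ({X : Finset G // (1 : G) ∈ X} → k) :=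
    parLift (partialTranslation k G) (isPartialRep_partialTranslation k G)
  let ev : ParAlg k G →ₗ[k] ({X : Finset G // (1 : G) ∈ X} → k) :=
    (LinearMap.applyₗ (1 : {X : Finset G // (1 : G) ∈ X} → k)).comp φ.toLinearMap
  refine LinearIndependent.of_comp ev ?_
  have h : ∀ X : {X : Finset G // (1 : G) ∈ X},
      ev (parP (fun g : G => parGen k g) X.1) = Pi.single X 1 := fun X => by
    have hX := map_parP_eq_map_booleanAtom (φ : ParAlg k G →+* _)
      (Algebra.lmul k ({X : Finset G // (1 : G) ∈ X} → k)).toRingHom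
      (π := fun g : G => parGen k g) (a := fun g Y => if g ∈ Y.1 then 1 else 0)
      (fun g => by
        simpa [φ, parLift_parGen] using partialTranslation_mul_inv k G g) X.1
    rw [booleanAtom_mem_indicator] at hX
    simpa [ev] using congrArg (fun T => T 1) hX
  convert (Pi.basisFun k {X : Finset G // (1 : G) ∈ X}).linearIndependent using 1
  funext X
  simpa using h X

open scoped IsMulCommutative in
/-- For a partial representation on an algebra, the elements `parP π X` with `1 ∈ X` span the
subalgebra generated by the elements `π g * π g⁻¹`. -/
theorem IsPartialRep.span_parP {k G B : Type*} [CommRing k] [Group G] [Fintype G]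
    [DecidableEq G] [Ring B] [Algebra k B] {π : G → B} (hπ : IsPartialRep π) :
    Submodule.span k (Set.range fun X : {X : Finset G // (1 : G) ∈ X} => parP π X.1) =
      Subalgebra.toSubmodule (Algebra.adjoin k (Set.range fun g : G => π g * π g⁻¹)) := by
  let E := Algebra.adjoin k (Set.range fun g : G => π g * π g⁻¹)
  have : IsMulCommutative E := Algebra.isMulCommutative_adjoin k (by
    rintro _ ⟨g, rfl⟩ _ ⟨h, rfl⟩
    exact hπ.commute g h)
  let e : G → E := fun g => ⟨π g * π g⁻¹, Algebra.subset_adjoin ⟨g, rfl⟩⟩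
  let j : E →+* B := E.val.toRingHom
  have he : ∀ g, IsIdempotentElem (e g) := fun g => Subtype.ext (hπ.isIdempotentElem g)
  have hone : e 1 = 1 := Subtype.ext (by simp [e, hπ.1])
  have hP : ∀ X, parP π X = j (booleanAtom e X) := fun X =>
    map_parP_eq_map_booleanAtom (RingHom.id B) j (fun _ => rfl) X
  have hP_zero : ∀ X : Finset G, (1 : G) ∉ X → parP π X = 0 := fun X hX => by
    have h := mul_booleanAtom_of_notMem he hX
    rw [hone, one_mul] at h
    rw [hP, h, map_zero]
  set S := Submodule.span k
    (Set.range fun X : {X : Finset G // (1 : G) ∈ X} => parP π X.1) with hS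
  have hPS : ∀ X, parP π X ∈ S := fun X => by
    by_cases hX : (1 : G) ∈ X
    · exact Submodule.subset_span ⟨⟨X, hX⟩, rfl⟩
    · rw [hP_zero X hX]
      exact S.zero_mem
  have hmul_gen : ∀ g : G, ∀ s ∈ S, π g * π g⁻¹ * s ∈ S := fun g s hs => by
    induction hs using Submodule.span_induction with
    | mem x hx =>
      obtain ⟨X, rfl⟩ := hx
      change j (e g) * parP π X.1 ∈ S
      rw [hP, ← map_mul]
      by_cases hg : g ∈ X.1
      · rw [mul_booleanAtom_of_mem he hg, ← hP]
        exact hPS X.1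
      · rw [mul_booleanAtom_of_notMem he hg, map_zero]
        exact S.zero_mem
    | zero => simp
    | add x y _ _ hx hy => rw [mul_add]; exact S.add_mem hx hy
    | smul c x _ hx => rw [mul_smul_comm]; exact S.smul_mem c hx
  have hmul : ∀ a ∈ E, ∀ s ∈ S, a * s ∈ S := fun a ha => by
    induction ha using Algebra.adjoin_induction with
    | mem x hx =>
      obtain ⟨g, rfl⟩ := hx
      exact hmul_gen g
    | algebraMap c =>
      intro s hs
      rw [← Algebra.smul_def]
      exact S.smul_mem c hs
    | add x y _ _ hx hy =>
      intro s hs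
      rw [add_mul]
      exact S.add_mem (hx s hs) (hy s hs)
    | mul x y _ _ hx hy =>
      intro s hs
      rw [mul_assoc]
      exact hx _ (hy s hs)
  have hone_mem : (1 : B) ∈ S := by
    rw [← map_one j, ← sum_booleanAtom e, map_sum]
    exact S.sum_mem fun X _ => hP X ▸ hPS X
  refine le_antisymm (Submodule.span_le.2 ?_) fun a ha => ?_
  · rintro _ ⟨X, rfl⟩
    change parP π X.1 ∈ E
    rw [hP]
    exact (booleanAtom e X.1).2
  · simpa using hmul a ha 1 hone_mem

/-- For a finite group `G`, the family `(P_X)`, indexed by subsets `X ⊆ G` with `e ∈ X`,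
is a `k`-linear basis of the subalgebra `A_par ⊆ k_par G` generated by the elements
`ε_g = [g][g⁻¹]`. -/
theorem aPar_basis
    (k : Type*) [Field k] (G : Type*) [Group G] [Fintype G] [DecidableEq G] :
    LinearIndependent k
        (fun X : {X : Finset G // (1 : G) ∈ X} =>
          parP (fun g : G => parGen k g) X.1) ∧
      Submodule.span k
          (Set.range fun X : {X : Finset G // (1 : G) ∈ X} =>
            parP (fun g : G => parGen k g) X.1) =
        Subalgebra.toSubmodule
          (Algebra.adjoin k (Set.range fun g : G => parGen k g * parGen k g⁻¹)) := by
  exact ⟨linearIndependent_parP k G, (isPartialRep_parGen k G).span_parP⟩
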